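/- Let p = 3 and let λ = (λ_1 ≥ … ≥ λ_h > 0) be a 3-restricted 3-strict partition of n that is JS(0), i.e. λ_h = 1 and res(λ_i) = res(λ_{i+1} + 1) for all 1 ≤ i < h, where res(a) = min(c-1, 3-c) for a = 3b + c, 1 ≤ c ≤ 3. Then n ≢ 2 (mod 3). -/

import Mathlib

/-- The spin residue of a node in column `a`: writing `a = b·p + c` with
`1 ≤ c ≤ p`, `res(a) = min (c - 1) (p - c)`. -/
def spinRes (p a : ℕ) : ℕ :=
  let c := if a % p = 0 then p else a % p
  min (c - 1) (p - c)

theorem spinRes_three (a : ℕ) : spinRes 3 a = if a % 3 = 2 then 1 else 0 := by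
  have h : a % 3 = 0 ∨ a % 3 = 1 ∨ a % 3 = 2 := by omega
  rcases h with h | h | h <;> simp [spinRes, h]

theorem stmt11_aux (l : List ℕ) : ∀ (hne : l ≠ []) (_ : l.getLast hne = 1)
    (_ : ∀ i, i + 1 < l.length →
      spinRes 3 (l.getD i 0) = spinRes 3 (l.getD (i + 1) 0 + 1)),
    (l.getD 0 0 % 3 = 1 ∧ l.sum % 3 = 1) ∨ (l.getD 0 0 % 3 ≠ 1 ∧ l.sum % 3 = 0) := by
  induction l with
  | nil => intro hne; exact absurd rfl hne
  | cons a t ih =>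
    intro hne hlast hres
    cases t with
    | nil => simp at hlast; simp [hlast]
    | cons b t =>
      have h1 := ih (by simp) (by simpa using hlast) (fun i hi => by
        have := hres (i + 1) (by simpa using hi)
        simpa using this)
      have h2 := hres 0 (by simp)
      simp only [spinRes_three, List.getD_cons_zero, List.getD_cons_succ, List.sum_cons] at h1 h2 ⊢
      split_ifs at h2 <;> omega

theorem stmt11 (n : ℕ) (l : List ℕ) (hne : l ≠ [])
    (hpos : ∀ x ∈ l, 0 < x)
    (hdec : ∀ i, i + 1 < l.length → l.getD (i + 1) 0 ≤ l.getD i 0)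
    (hRP : ∀ i < l.length,
      1 - (if 3 ∣ l.getD i 0 then 1 else 0) ≤ l.getD i 0 - l.getD (i + 1) 0 ∧
      l.getD i 0 - l.getD (i + 1) 0 ≤ 3 - (if 3 ∣ l.getD i 0 then 1 else 0))
    (hsum : l.sum = n)
    (hlast : l.getLast hne = 1)
    (hres : ∀ i, i + 1 < l.length →
      spinRes 3 (l.getD i 0) = spinRes 3 (l.getD (i + 1) 0 + 1)) :
    n % 3 ≠ 2 := by
  have h := stmt11_aux l hne hlast hres
  omega
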